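/- Let H be a real Hilbert space, (φ_n)_{n∈ℕ} an orthonormal family in H, and λ : ℕ → ℝ a sequence with λ_n > 0 for all n. Let T > 0, δ > 0, M > 0, and g ∈ H. For j = 1, 2 let c^j : ℕ → ℝ satisfy ∑_n (c^j_n)² e^{2λ_n T} < ∞ and define u_j(t) = ∑_n c^j_n e^{λ_n t} φ_n for t ∈ [0, T]. If ‖u_j(0) − g‖ ≤ δ and ‖u_j(T)‖ ≤ M for j = 1, 2, then for every t ∈ [0, T], ‖u_1(t) − u_2(t)‖ ≤ 2 M^{t/T} δ^{1 − t/T}. -/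

import Mathlib

/-- Parseval's identity for a real square-summable series along an orthonormal family. -/
theorem Orthonormal.summable_smul_and_hasSum_sq {ι H : Type*} [NormedAddCommGroup H]
    [InnerProductSpace ℝ H] [CompleteSpace H] {φ : ι → H} (hφ : Orthonormal ℝ φ) {a : ι → ℝ}
    (ha : Summable fun n => a n ^ 2) :
    (Summable fun n => a n • φ n) ∧ HasSum (fun n => a n ^ 2) (‖∑' n, a n • φ n‖ ^ 2) := by
  have hs : Summable fun n => a n • φ n := by
    have h := hφ.orthogonalFamily.summable_iff_norm_sq_summable a
    simp only [LinearIsometry.toSpanSingleton_apply, Real.norm_eq_abs, sq_abs] at h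
    exact h.2 ha
  refine ⟨hs, ?_⟩
  have hlim : Filter.Tendsto (fun s : Finset ι => ‖∑ n ∈ s, a n • φ n‖ ^ 2) Filter.atTop
      (nhds (‖∑' n, a n • φ n‖ ^ 2)) := (hs.hasSum.norm).pow 2
  refine hlim.congr fun s => ?_
  have h := hφ.orthogonalFamily.norm_sum a s
  simpa only [LinearIsometry.toSpanSingleton_apply, Real.norm_eq_abs, sq_abs] using h

/-- Weighted arithmetic-geometric mean inequality for an exponential, with free scales. -/
theorem exp_mul_le_scaled_convex_combination {D N θ : ℝ} (hD : 0 < D) (hN : 0 < N)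
    (h0 : 0 ≤ θ) (h1 : θ ≤ 1) (x : ℝ) :
    Real.exp (θ * x) ≤
      (D ^ (1 - θ) * N ^ θ) ^ 2 * ((1 - θ) / D ^ 2 + θ * Real.exp x / N ^ 2) := by
  have h := Real.geom_mean_le_arith_mean2_weighted (sub_nonneg.2 h1) h0
    (inv_nonneg.2 (sq_nonneg D)) (div_nonneg (Real.exp_nonneg x) (sq_nonneg N)) (by ring)
  have hD2 : (D ^ 2) ^ (1 - θ) = (D ^ (1 - θ)) ^ 2 := (Real.rpow_pow_comm hD.le _ _).symm
  have hN2 : (N ^ 2) ^ θ = (N ^ θ) ^ 2 := (Real.rpow_pow_comm hN.le _ _).symm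
  have he : Real.exp x ^ θ = Real.exp (θ * x) := by rw [← Real.exp_mul, mul_comm]
  rw [Real.inv_rpow (sq_nonneg D), Real.div_rpow (Real.exp_nonneg x) (sq_nonneg N),
    hD2, hN2, he] at h
  have hDp := Real.rpow_pos_of_pos hD (1 - θ)
  have hNp := Real.rpow_pos_of_pos hN θ
  calc Real.exp (θ * x)
      = (D ^ (1 - θ) * N ^ θ) ^ 2 *
          (((D ^ (1 - θ)) ^ 2)⁻¹ * (Real.exp (θ * x) / (N ^ θ) ^ 2)) := by field_simp
    _ ≤ (D ^ (1 - θ) * N ^ θ) ^ 2 * ((1 - θ) * (D ^ 2)⁻¹ + θ * (Real.exp x / N ^ 2)) := by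
      gcongr
    _ = _ := by ring

/-- Interpolation of spectral sums between the times `0` and `T`. -/
theorem norm_tsum_exp_smul_le_interpolation {ι H : Type*} [NormedAddCommGroup H]
    [InnerProductSpace ℝ H] [CompleteSpace H] {φ : ι → H} (hφ : Orthonormal ℝ φ)
    {lam d : ι → ℝ} {T t D N : ℝ} (hT : 0 < T) (hD : 0 < D) (hN : 0 < N)
    (ht : t ∈ Set.Icc 0 T)
    (hs : ∀ s ∈ Set.Icc 0 T, Summable fun n => (d n * Real.exp (lam n * s)) ^ 2)
    (h0 : ‖∑' n, (d n * Real.exp (lam n * 0)) • φ n‖ ≤ D)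
    (h1 : ‖∑' n, (d n * Real.exp (lam n * T)) • φ n‖ ≤ N) :
    ‖∑' n, (d n * Real.exp (lam n * t)) • φ n‖ ≤ D ^ (1 - t / T) * N ^ (t / T) := by
  have hθ0 : 0 ≤ t / T := div_nonneg ht.1 hT.le
  have hθ1 : t / T ≤ 1 := (div_le_one hT).2 ht.2
  have s0 := (hφ.summable_smul_and_hasSum_sq (hs 0 ⟨le_rfl, hT.le⟩)).2
  have sT := (hφ.summable_smul_and_hasSum_sq (hs T ⟨hT.le, le_rfl⟩)).2
  have st := (hφ.summable_smul_and_hasSum_sq (hs t ht)).2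
  have hsum := ((s0.mul_left ((1 - t / T) / D ^ 2)).add
    (sT.mul_left (t / T / N ^ 2))).mul_left ((D ^ (1 - t / T) * N ^ (t / T)) ^ 2)
  have hle := hasSum_le (fun n => ?_) st hsum
  · refine le_of_sq_le_sq (hle.trans ?_) (by positivity)
    have hc : (1 - t / T) / D ^ 2 * D ^ 2 + t / T / N ^ 2 * N ^ 2 = 1 := by
      field_simp
      ring
    refine mul_le_of_le_one_right (sq_nonneg _) (le_trans ?_ hc.le)
    have := sub_nonneg.2 hθ1
    gcongr
  · have h := mul_le_mul_of_nonneg_left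
      (exp_mul_le_scaled_convex_combination hD hN hθ0 hθ1 (2 * (lam n * T))) (sq_nonneg (d n))
    have e1 : t / T * (2 * (lam n * T)) = lam n * t + lam n * t := by
      field_simp
      ring
    rw [e1, Real.exp_add, two_mul (lam n * T), Real.exp_add] at h
    rw [mul_zero, Real.exp_zero]
    calc _ = d n ^ 2 * (Real.exp (lam n * t) * Real.exp (lam n * t)) := by ring
      _ ≤ _ := h
      _ = _ := by ring

/-- Square-summability of the spectral coefficients propagates to earlier times. -/
theorem summable_sq_mul_exp_of_le {ι : Type*} {lam c : ι → ℝ} {T s : ℝ} (hpos : ∀ n, 0 < lam n)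
    (hs : s ≤ T) (h : Summable fun n => c n ^ 2 * Real.exp (2 * lam n * T)) :
    Summable fun n => (c n * Real.exp (lam n * s)) ^ 2 := by
  refine h.of_nonneg_of_le (fun n => sq_nonneg _) fun n => ?_
  rw [mul_pow, ← Real.exp_nat_mul, mul_assoc 2 (lam n)]
  have := (hpos n).le
  push_cast
  gcongr

/-- F. John's Hölder-type stability estimate: two spectral solutions of the
backward parabolic problem satisfying `‖uⱼ(0) − g‖ ≤ δ` and `‖uⱼ(T)‖ ≤ M` satisfy
`‖u₁(t) − u₂(t)‖ ≤ 2 M^{t/T} δ^{1−t/T}` for all `t ∈ [0,T]`. -/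
theorem john_holder_stability
    {H : Type*} [NormedAddCommGroup H] [InnerProductSpace ℝ H] [CompleteSpace H]
    (φ : ℕ → H) (hφ : Orthonormal ℝ φ)
    (lam : ℕ → ℝ) (hpos : ∀ n, 0 < lam n)
    (T δ M : ℝ) (hT : 0 < T) (hδ : 0 < δ) (hM : 0 < M)
    (g : H) (c₁ c₂ : ℕ → ℝ)
    (hsum₁ : Summable (fun n => c₁ n ^ 2 * Real.exp (2 * lam n * T)))
    (hsum₂ : Summable (fun n => c₂ n ^ 2 * Real.exp (2 * lam n * T)))
    (u₁ u₂ : ℝ → H)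
    (hu₁ : ∀ t, u₁ t = ∑' n, (c₁ n * Real.exp (lam n * t)) • φ n)
    (hu₂ : ∀ t, u₂ t = ∑' n, (c₂ n * Real.exp (lam n * t)) • φ n)
    (hinit₁ : ‖u₁ 0 - g‖ ≤ δ) (hinit₂ : ‖u₂ 0 - g‖ ≤ δ)
    (hbound₁ : ‖u₁ T‖ ≤ M) (hbound₂ : ‖u₂ T‖ ≤ M) :
    ∀ t ∈ Set.Icc (0 : ℝ) T, ‖u₁ t - u₂ t‖ ≤ 2 * M ^ (t / T) * δ ^ (1 - t / T) := by
  intro t ht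
  have hsq₁ := fun s (hs : s ∈ Set.Icc 0 T) => summable_sq_mul_exp_of_le hpos hs.2 hsum₁
  have hsq₂ := fun s (hs : s ∈ Set.Icc 0 T) => summable_sq_mul_exp_of_le hpos hs.2 hsum₂
  have hdiff : ∀ s ∈ Set.Icc 0 T,
      u₁ s - u₂ s = ∑' n, ((c₁ n - c₂ n) * Real.exp (lam n * s)) • φ n := fun s hs => by
    rw [hu₁, hu₂, ← (hφ.summable_smul_and_hasSum_sq (hsq₁ s hs)).1.tsum_sub
      (hφ.summable_smul_and_hasSum_sq (hsq₂ s hs)).1]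
    simp only [sub_mul, sub_smul]
  have hsq : ∀ s ∈ Set.Icc 0 T,
      Summable fun n => ((c₁ n - c₂ n) * Real.exp (lam n * s)) ^ 2 := fun s hs => by
    refine (((hsq₁ s hs).add (hsq₂ s hs)).mul_left 2).of_nonneg_of_le (fun n => sq_nonneg _)
      fun n => ?_
    nlinarith [sq_nonneg (c₁ n * Real.exp (lam n * s) + c₂ n * Real.exp (lam n * s))]
  have h0 : ‖u₁ 0 - u₂ 0‖ ≤ 2 * δ := by
    rw [← sub_sub_sub_cancel_right _ _ g]
    linarith [norm_sub_le (u₁ 0 - g) (u₂ 0 - g)]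
  have h1 : ‖u₁ T - u₂ T‖ ≤ 2 * M := by linarith [norm_sub_le (u₁ T) (u₂ T)]
  rw [hdiff 0 ⟨le_rfl, hT.le⟩] at h0
  rw [hdiff T ⟨hT.le, le_rfl⟩] at h1
  rw [hdiff t ht]
  refine (norm_tsum_exp_smul_le_interpolation hφ hT (by positivity) (by positivity) ht hsq
    h0 h1).trans_eq ?_
  rw [Real.mul_rpow two_pos.le hδ.le, Real.mul_rpow two_pos.le hM.le, mul_mul_mul_comm,
    ← Real.rpow_add two_pos, sub_add_cancel, Real.rpow_one]
  ring
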